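/- Let m ≥ 3 and let x, x′ ∈ C_0 ∖ ⋃N_m. Then RP^UF(x) = RP^UF(x′) if and only if x and x′ lie in the same chamber of the arrangement N_m. -/

import Mathlib

/-- The union of the hyperplanes of the braid arrangement `B_m` in `ℝ^m`:
`x_i = x_j` for `1 ≤ i < j ≤ m`. -/
def braidUnion (m : ℕ) : Set (Fin m → ℝ) :=
  ⋃ i : Fin m, ⋃ j : Fin m, ⋃ _ : i < j, {x | x i = x j}

/-- The union of the hyperplanes of the arrangement `N_m` in `ℝ^m`:
`x_i + x_j = x_k + x_l` for quadruples of distinct indices `(i,j,k,l)` with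
`i < j`, `i < k < l`. -/
def midUnion (m : ℕ) : Set (Fin m → ℝ) :=
  ⋃ i : Fin m, ⋃ j : Fin m, ⋃ k : Fin m, ⋃ l : Fin m,
    ⋃ _ : i < j, ⋃ _ : i < k, ⋃ _ : k < l, ⋃ _ : j ≠ k, ⋃ _ : j ≠ l,
      {x | x i + x j = x k + x l}

/-- The union of the hyperplanes of the mid-hyperplane arrangement
`M_m = B_m ∪ N_m`. -/
def midHyperplaneUnion (m : ℕ) : Set (Fin m → ℝ) :=
  braidUnion m ∪ midUnion m

/-- The chamber `C_0 = {x : x_1 < ⋯ < x_m}` of the braid arrangement. -/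
def C0 (m : ℕ) : Set (Fin m → ℝ) := {x | StrictMono x}

/-- The ranking pattern of the unidimensional unfolding model with objects
`x_1, …, x_m ∈ ℝ`: the set of rankings `(i_1 ⋯ i_m)` (permutations of
`{1,…,m}`, where `σ k = i_k`) such that
`|y - x_{i_1}| < ⋯ < |y - x_{i_m}|` for some `y ∈ ℝ`. -/
def RPUF {m : ℕ} (x : Fin m → ℝ) : Set (Equiv.Perm (Fin m)) :=
  {σ | ∃ y : ℝ, ∀ k l : Fin m, k < l → |y - x (σ k)| < |y - x (σ l)|}

/-- The chambers of an arrangement with union of hyperplanes `U`: the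
connected components of the complement of `U`. -/
def chambersOf {m : ℕ} (U : Set (Fin m → ℝ)) : Set (Set (Fin m → ℝ)) :=
  {C | ∃ y ∈ Uᶜ, C = connectedComponentIn Uᶜ y}

/-- `r_0(m)`: the number of ranking patterns of unidimensional unfolding
models with generic `m`-tuples such that `x_1 < ⋯ < x_m`. -/
noncomputable def r0 (m : ℕ) : ℕ :=
  {R : Set (Equiv.Perm (Fin m)) | ∃ x ∈ C0 m \ midUnion m, R = RPUF x}.ncard

theorem add_ne_add_of_notMem_midUnion {m : ℕ} {x : Fin m → ℝ} (hx : x ∉ midUnion m)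
    {i j k l : Fin m} (hij : i ≠ j) (hkl : k ≠ l) (hik : i ≠ k) (hil : i ≠ l) (hjk : j ≠ k)
    (hjl : j ≠ l) : x i + x j ≠ x k + x l := by
  wlog h : i < j generalizing i j
  · rw [add_comm (x i)]
    exact this hij.symm hjk hjl hik hil (lt_of_le_of_ne (not_lt.1 h) hij.symm)
  wlog h' : k < l generalizing k l
  · rw [add_comm (x k)]
    exact this hkl.symm hil hik hjl hjk (lt_of_le_of_ne (not_lt.1 h') hkl.symm)
  intro he
  refine hx ?_
  simp only [midUnion, Set.mem_iUnion]
  rcases lt_or_gt_of_ne hik with hik' | hik'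
  · exact ⟨i, j, k, l, h, hik', h', hjk, hjl, he⟩
  · exact ⟨k, l, i, j, h', hik', h, hil.symm, hjl.symm, he.symm⟩

/-- Every strict inequality `x_i + x_j < x_k + x_l` between sums over disjoint pairs of indices
also holds for `x'`. -/
def MidOrderLE {m : ℕ} (x x' : Fin m → ℝ) : Prop :=
  ∀ i j k l : Fin m, i ≠ j → k ≠ l → i ≠ k → i ≠ l → j ≠ k → j ≠ l →
    x i + x j < x k + x l → x' i + x' j < x' k + x' l

theorem MidOrderLE.symm {m : ℕ} {x x' : Fin m → ℝ} (h : MidOrderLE x x')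
    (hx : x ∉ midUnion m) : MidOrderLE x' x := by
  intro i j k l hij hkl hik hil hjk hjl hlt
  by_contra hn
  have hne := add_ne_add_of_notMem_midUnion hx hij hkl hik hil hjk hjl
  have := h k l i j hkl hij hik.symm hjk.symm hil.symm hjl.symm
    (lt_of_le_of_ne (not_lt.1 hn) hne.symm)
  exact lt_asymm hlt this

theorem MidOrderLE.add_lt_add {m : ℕ} {x x' : Fin m → ℝ} (h : MidOrderLE x x')
    (hx : StrictMono x) (hx' : StrictMono x') {i j k l : Fin m} (hij : i ≠ j) (hkl : k ≠ l)
    (hlt : x i + x j < x k + x l) : x' i + x' j < x' k + x' l := by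
  have key (a b : Fin m) (hab : x a < x b) : x' a < x' b := hx' (hx.lt_iff_lt.1 hab)
  by_cases hik : i = k
  · subst hik
    linarith [key j l (by linarith)]
  by_cases hil : i = l
  · subst hil
    linarith [key j k (by linarith)]
  by_cases hjk : j = k
  · subst hjk
    linarith [key i l (by linarith)]
  by_cases hjl : j = l
  · subst hjl
    linarith [key i k (by linarith)]
  exact h i j k l hij hkl hik hil hjk hjl hlt

theorem abs_sub_lt_abs_sub_iff_of_lt {y a b : ℝ} (h : a < b) :
    |y - a| < |y - b| ↔ 2 * y < a + b := by
  rw [← sq_lt_sq]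
  constructor <;> intro h' <;> nlinarith

theorem abs_sub_lt_abs_sub_iff_of_gt {y a b : ℝ} (h : b < a) :
    |y - a| < |y - b| ↔ a + b < 2 * y := by
  rw [← sq_lt_sq]
  constructor <;> intro h' <;> nlinarith

theorem MidOrderLE.RPUF_subset {m : ℕ} {x x' : Fin m → ℝ} (h : MidOrderLE x x')
    (hx : StrictMono x) (hx' : StrictMono x') : RPUF x ⊆ RPUF x' := by
  rintro σ ⟨y, hy⟩
  let s (p : Fin m × Fin m) : ℝ := x' (σ p.1) + x' (σ p.2)
  obtain ⟨z, hlo, hhi⟩ := Order.exists_between_finsets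
    (lo := (Finset.univ.filter fun p : Fin m × Fin m ↦ p.1 < p.2 ∧ σ p.2 < σ p.1).image s)
    (hi := (Finset.univ.filter fun p : Fin m × Fin m ↦ p.1 < p.2 ∧ σ p.1 < σ p.2).image s) (by
      simp only [Finset.mem_image, Finset.mem_filter, Finset.mem_univ, true_and]
      rintro _ ⟨p, ⟨hp, hp'⟩, rfl⟩ _ ⟨q, ⟨hq, hq'⟩, rfl⟩
      exact h.add_lt_add hx hx' hp'.ne' hq'.ne
        (((abs_sub_lt_abs_sub_iff_of_gt (hx hp')).1 (hy _ _ hp)).trans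
          ((abs_sub_lt_abs_sub_iff_of_lt (hx hq')).1 (hy _ _ hq))))
  refine ⟨z / 2, fun k l hkl ↦ ?_⟩
  rcases lt_or_gt_of_ne (σ.injective.ne hkl.ne) with hσ | hσ
  · rw [abs_sub_lt_abs_sub_iff_of_lt (hx' hσ), mul_div_cancel₀ z two_ne_zero]
    exact hhi _ (Finset.mem_image.2 ⟨(k, l), by simp [hkl, hσ], rfl⟩)
  · rw [abs_sub_lt_abs_sub_iff_of_gt (hx' hσ), mul_div_cancel₀ z two_ne_zero]
    exact hlo _ (Finset.mem_image.2 ⟨(k, l), by simp [hkl, hσ], rfl⟩)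

/-- Away from the midpoints of `x`, every ideal point `y` determines a ranking. -/
theorem exists_perm_strictMono_abs_sub {m : ℕ} {x : Fin m → ℝ} (hx : StrictMono x) {y : ℝ}
    (hy : ∀ i j, x i + x j ≠ 2 * y) :
    ∃ σ : Equiv.Perm (Fin m), StrictMono fun k ↦ |y - x (σ k)| := by
  let σ := Tuple.sort fun i ↦ |y - x i|
  have hσ : Monotone fun k ↦ |y - x (σ k)| := Tuple.monotone_sort fun i ↦ |y - x i|
  refine ⟨σ, hσ.strictMono_of_injective fun a b hab ↦ σ.injective (hx.injective ?_)⟩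
  rcases abs_eq_abs.1 hab with h | h
  · linarith
  · exact (hy (σ a) (σ b) (by linear_combination -h)).elim

theorem midOrderLE_of_RPUF_subset {m : ℕ} {x x' : Fin m → ℝ} (hx : StrictMono x)
    (hx' : StrictMono x') (h : RPUF x ⊆ RPUF x') : MidOrderLE x x' := by
  intro i j k l hij hkl hik hil hjk hjl hlt
  wlog hij' : i < j generalizing i j
  · rw [add_comm (x' i)]
    exact this j i hij.symm hjk hjl hik hil (by linarith)
      (lt_of_le_of_ne (not_lt.1 hij') hij.symm)
  wlog hkl' : k < l generalizing k l
  · rw [add_comm (x' k)]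
    exact this l k hkl.symm hil hik hjl hjk (by linarith)
      (lt_of_le_of_ne (not_lt.1 hkl') hkl.symm)
  obtain ⟨z, ⟨hz₁, hz₂⟩, hz⟩ := (Set.Ioo_infinite hlt).exists_notMem_finite
    (Set.finite_range fun p : Fin m × Fin m ↦ x p.1 + x p.2)
  have h2 : 2 * (z / 2) = z := mul_div_cancel₀ z two_ne_zero
  obtain ⟨σ, hσ⟩ := exists_perm_strictMono_abs_sub hx (y := z / 2)
    fun a b hab ↦ hz ⟨(a, b), hab.trans h2⟩
  obtain ⟨y', hy'⟩ := h (show σ ∈ RPUF x from ⟨z / 2, fun _ _ hab ↦ hσ hab⟩)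
  have transfer (a b : Fin m) (hab : |z / 2 - x a| < |z / 2 - x b|) :
      |y' - x' a| < |y' - x' b| := by
    have := hy' (σ.symm a) (σ.symm b) (hσ.lt_iff_lt.1 (by simpa using hab))
    simpa using this
  have h₁ := (abs_sub_lt_abs_sub_iff_of_gt (hx' hij')).1
    (transfer j i ((abs_sub_lt_abs_sub_iff_of_gt (hx hij')).2 (by linarith)))
  have h₂ := (abs_sub_lt_abs_sub_iff_of_lt (hx' hkl')).1
    (transfer k l ((abs_sub_lt_abs_sub_iff_of_lt (hx hkl')).2 (by linarith)))
  linarith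

theorem MidOrderLE.segment_subset {m : ℕ} {x x' : Fin m → ℝ} (h : MidOrderLE x x')
    (hx : x ∉ midUnion m) : segment ℝ x x' ⊆ (midUnion m)ᶜ := by
  rintro _ ⟨a, b, ha, hb, hab, rfl⟩ hmem
  simp only [midUnion, Set.mem_iUnion, Set.mem_ofPred_eq, Pi.add_apply, Pi.smul_apply,
    smul_eq_mul] at hmem
  obtain ⟨i, j, k, l, hij, hik, hkl, hjk, hjl, he⟩ := hmem
  have hil := (hik.trans hkl).ne
  have pos {u v : ℝ} (hu : 0 < u) (hv : 0 < v) : 0 < a * u + b * v := by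
    rcases ha.eq_or_lt with rfl | ha
    · have : b = 1 := by linarith
      subst this
      linarith
    · have := mul_pos ha hu
      have := mul_nonneg hb hv.le
      linarith
  rcases lt_or_gt_of_ne (add_ne_add_of_notMem_midUnion hx hij.ne hkl.ne hik.ne hil hjk hjl)
    with hlt | hlt
  · have h' := h i j k l hij.ne hkl.ne hik.ne hil hjk hjl hlt
    linarith [pos (sub_pos.2 hlt) (sub_pos.2 h')]
  · have h' := h k l i j hkl.ne hij.ne hik.ne' hjk.symm hil.symm hjl.symm hlt
    linarith [pos (sub_pos.2 hlt) (sub_pos.2 h')]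

theorem midOrderLE_of_isPreconnected {m : ℕ} {x x' : Fin m → ℝ} {s : Set (Fin m → ℝ)}
    (hs : IsPreconnected s) (hsub : s ⊆ (midUnion m)ᶜ) (hx : x ∈ s) (hx' : x' ∈ s) :
    MidOrderLE x x' := by
  intro i j k l hij hkl hik hil hjk hjl hlt
  by_contra hn
  obtain ⟨z, hz, he⟩ := hs.intermediate_value₂ hx hx' (f := fun z ↦ z i + z j)
    (g := fun z ↦ z k + z l) (by fun_prop) (by fun_prop) hlt.le (not_lt.1 hn)
  exact add_ne_add_of_notMem_midUnion (hsub hz) hij hkl hik hil hjk hjl he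

theorem connectedComponentIn_eq_iff_midOrderLE {m : ℕ} {x x' : Fin m → ℝ}
    (hx : x ∉ midUnion m) (hx' : x' ∉ midUnion m) :
    connectedComponentIn (midUnion m)ᶜ x = connectedComponentIn (midUnion m)ᶜ x' ↔
      MidOrderLE x x' := by
  refine ⟨fun h ↦ ?_, fun h ↦ ?_⟩
  · exact midOrderLE_of_isPreconnected isPreconnected_connectedComponentIn
      (connectedComponentIn_subset _ _) (mem_connectedComponentIn hx)
      (h ▸ mem_connectedComponentIn hx')
  · exact connectedComponentIn_eq ((convex_segment x x').isPreconnected.subset_connectedComponentIn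
      (left_mem_segment ℝ x x') (h.segment_subset hx) (right_mem_segment ℝ x x'))

/-- Lemma (Kamiya–Orlik–Takemura–Terao): for `x, x' ∈ C_0 ∖ ⋃N_m`, the ranking
patterns `RP^UF(x)` and `RP^UF(x')` coincide iff `x` and `x'` lie in the same
chamber of `N_m`. -/
theorem ranking_pattern_eq_iff_same_chamber
    (m : ℕ) (hm : 3 ≤ m) (x x' : Fin m → ℝ)
    (hx : x ∈ C0 m \ midUnion m) (hx' : x' ∈ C0 m \ midUnion m) :
    RPUF x = RPUF x' ↔
      connectedComponentIn (midUnion m)ᶜ x =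
        connectedComponentIn (midUnion m)ᶜ x' := by
  rw [connectedComponentIn_eq_iff_midOrderLE hx.2 hx'.2]
  exact ⟨fun h ↦ midOrderLE_of_RPUF_subset hx.1 hx'.1 h.subset,
    fun h ↦ (h.RPUF_subset hx.1 hx'.1).antisymm ((h.symm hx.2).RPUF_subset hx'.1 hx.1)⟩
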